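/- arXiv:2302.13710 — 2 statements merged into one kernel-verified Lean document; each statement's English description precedes it below -/
import Mathlib

section
/- (Strict policy dominance) Suppose β > 0. Let y ∈ ℝ and let d̃* ∈ D be optimal for the pseudo problem at y. If a policy d ∈ D satisfies μ^d ∈ (y − |y − μ^{d̃*}|, y + |y − μ^{d̃*}|) (equivalently |μ^d − y| < |μ^{d̃*} − y|), then η^{d̃*} < η^d. -/
open Finset

/-- The steady-state mean `μ = ∑ i, π i * r i` of a reward vector `r` under a
probability vector `π`. -/
def mdpMean {S : Type*} [Fintype S] (π r : S → ℝ) : ℝ := ∑ i, π i * r i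

/-- The steady-state variance `σ = ∑ i, π i * (r i - μ)²`. -/
def mdpVar {S : Type*} [Fintype S] (π r : S → ℝ) : ℝ :=
  ∑ i, π i * (r i - mdpMean π r)^2

/-- The pseudo variance `σ̃(y) = ∑ i, π i * (r i - y)²` with pseudo mean `y`. -/
def mdpPseudoVar {S : Type*} [Fintype S] (π r : S → ℝ) (y : ℝ) : ℝ :=
  ∑ i, π i * (r i - y)^2

/-- The mean-variance objective `η = β·σ - μ`. -/
def mdpEta {S : Type*} [Fintype S] (π r : S → ℝ) (β : ℝ) : ℝ :=
  β * mdpVar π r - mdpMean π r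

/-- The pseudo mean-variance objective `η̃(y) = β·σ̃(y) - μ`. -/
def mdpPseudoEta {S : Type*} [Fintype S] (π r : S → ℝ) (β y : ℝ) : ℝ :=
  β * mdpPseudoVar π r y - mdpMean π r

/-- The optimal pseudo mean-variance objective `η̃*(y) = min_{d ∈ D} η̃^d(y)`. -/
def mdpPseudoEtaStar {S D : Type*} [Fintype S] [Fintype D] [Nonempty D]
    (π r : D → S → ℝ) (β y : ℝ) : ℝ :=
  Finset.univ.inf' Finset.univ_nonempty (fun d => mdpPseudoEta (π d) (r d) β y)

/-- The pseudo variance exceeds the variance by the squared gap between the mean and the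
pseudo mean. -/
theorem mdpPseudoVar_eq_mdpVar_add_sq {S : Type*} [Fintype S] {π : S → ℝ}
    (hπ : ∑ i, π i = 1) (r : S → ℝ) (y : ℝ) :
    mdpPseudoVar π r y = mdpVar π r + (mdpMean π r - y) ^ 2 := by
  have key (c : ℝ) : ∑ i, π i * (r i - c) ^ 2 =
      ∑ i, π i * r i ^ 2 - 2 * c * mdpMean π r + c ^ 2 := by
    have h : ∀ i, π i * (r i - c) ^ 2 =
        π i * r i ^ 2 - 2 * c * (π i * r i) + c ^ 2 * π i := fun i => by ring
    simp only [h, Finset.sum_add_distrib, Finset.sum_sub_distrib, ← Finset.mul_sum, hπ,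
      mdpMean, mul_one]
  rw [mdpPseudoVar, mdpVar, key, key]
  ring

/-- Strict policy dominance: if `β > 0`, `d̃*` is optimal for the pseudo problem at `y`,
and `μ^d ∈ (y - |y - μ^{d̃*}|, y + |y - μ^{d̃*}|)`, then `η^{d̃*} < η^d`. -/
theorem strict_policy_dominance {S D : Type*} [Fintype S] [Nonempty S]
    [Fintype D] [Nonempty D]
    (π r : D → S → ℝ)
    (hπ : ∀ d i, 0 ≤ π d i) (hπsum : ∀ d, ∑ i, π d i = 1)
    (β : ℝ) (hβ : 0 < β)
    (y : ℝ) (dtil : D)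
    (hopt : mdpPseudoEta (π dtil) (r dtil) β y = mdpPseudoEtaStar π r β y)
    (d : D)
    (hmem : mdpMean (π d) (r d) ∈
      Set.Ioo (y - |y - mdpMean (π dtil) (r dtil)|)
              (y + |y - mdpMean (π dtil) (r dtil)|)) :
    mdpEta (π dtil) (r dtil) β < mdpEta (π d) (r d) β := by
  have hle : mdpPseudoEta (π dtil) (r dtil) β y ≤ mdpPseudoEta (π d) (r d) β y :=
    hopt.trans_le (Finset.inf'_le _ (Finset.mem_univ d))
  have hsq : (mdpMean (π d) (r d) - y) ^ 2 < (mdpMean (π dtil) (r dtil) - y) ^ 2 := by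
    rw [sq_lt_sq, abs_sub_comm (mdpMean (π dtil) (r dtil)), abs_lt]
    constructor <;> linarith [hmem.1, hmem.2]
  simp only [mdpPseudoEta, mdpPseudoVar_eq_mdpVar_add_sq (hπsum _), mul_add] at hle
  simp only [mdpEta]
  linarith [mul_lt_mul_of_pos_left hsq hβ]
end

section
/- (Theorem 1, correctness of the domain-shrinking algorithm) Let L be a nonempty finite index set, and for each l ∈ L let y_l ∈ ℝ and let d_l ∈ D be a policy optimal for the pseudo problem at y_l. Suppose the removed intervals cover all policy means, i.e. for every d ∈ D there exists l ∈ L with μ^d ∈ [y_l − |y_l − μ^{d_l}|, y_l + |y_l − μ^{d_l}|]. Then the best policy found is globally optimal: min_{l ∈ L} η^{d_l} = min_{d ∈ D} η^d. -/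
open Finset

/-- The pseudo objective exceeds the mean-variance objective by `β * (μ - y)²`. -/
theorem mdpPseudoEta_eq_mdpEta_add {S : Type*} [Fintype S] (π r : S → ℝ)
    (hsum : ∑ i, π i = 1) (β y : ℝ) :
    mdpPseudoEta π r β y = mdpEta π r β + β * (mdpMean π r - y) ^ 2 := by
  have key (z : ℝ) :
      ∑ i, π i * (r i - z) ^ 2 = ∑ i, π i * r i ^ 2 - 2 * z * mdpMean π r + z ^ 2 := by
    calc ∑ i, π i * (r i - z) ^ 2
        = ∑ i, (π i * r i ^ 2 - 2 * z * (π i * r i) + z ^ 2 * π i) :=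
          sum_congr rfl fun i _ => by ring
      _ = _ := by
          rw [sum_add_distrib, sum_sub_distrib, ← mul_sum, ← mul_sum, hsum, mdpMean, mul_one]
  rw [mdpPseudoEta, mdpEta, mdpPseudoVar, mdpVar, key, key]
  ring

/-- A policy optimal for the pseudo problem at `y` is at least as good as every policy whose
mean is no farther from `y` than its own. -/
theorem mdpEta_le_of_pseudo_optimal {S D : Type*} [Fintype S] [Fintype D] [Nonempty D]
    (π r : D → S → ℝ) (hsum : ∀ d, ∑ i, π d i = 1) {β y : ℝ} (hβ : 0 ≤ β) {d' d : D}
    (hopt : mdpPseudoEta (π d') (r d') β y = mdpPseudoEtaStar π r β y)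
    (hd : |mdpMean (π d) (r d) - y| ≤ |mdpMean (π d') (r d') - y|) :
    mdpEta (π d') (r d') β ≤ mdpEta (π d) (r d) β := by
  have hle : mdpPseudoEta (π d') (r d') β y ≤ mdpPseudoEta (π d) (r d) β y :=
    hopt.trans_le (inf'_le _ (mem_univ d))
  rw [mdpPseudoEta_eq_mdpEta_add _ _ (hsum _), mdpPseudoEta_eq_mdpEta_add _ _ (hsum _)] at hle
  have hsq := mul_le_mul_of_nonneg_left (sq_le_sq.mpr hd) hβ
  linarith

/-- Theorem 1 (correctness of the domain-shrinking algorithm): if for each iteration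
`l ∈ L` the policy `dl l` is optimal for the pseudo problem at `yl l`, and the removed
intervals `[yl l - |yl l - μ^{dl l}|, yl l + |yl l - μ^{dl l}|]` cover the mean of every
policy, then the best policy found is globally optimal:
`min_{l ∈ L} η^{dl l} = min_{d ∈ D} η^d`. -/
theorem domain_shrinking_correct {S D : Type*} [Fintype S] [Nonempty S]
    [Fintype D] [Nonempty D]
    (π r : D → S → ℝ)
    (hπ : ∀ d i, 0 ≤ π d i) (hπsum : ∀ d, ∑ i, π d i = 1)
    (β : ℝ) (hβ : 0 ≤ β)
    {L : Type*} [Fintype L] [Nonempty L]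
    (yl : L → ℝ) (dl : L → D)
    (hopt : ∀ l : L,
      mdpPseudoEta (π (dl l)) (r (dl l)) β (yl l) = mdpPseudoEtaStar π r β (yl l))
    (hcover : ∀ d : D, ∃ l : L,
      mdpMean (π d) (r d) ∈
        Set.Icc (yl l - |yl l - mdpMean (π (dl l)) (r (dl l))|)
                (yl l + |yl l - mdpMean (π (dl l)) (r (dl l))|)) :
    Finset.univ.inf' Finset.univ_nonempty (fun l : L => mdpEta (π (dl l)) (r (dl l)) β)
      = Finset.univ.inf' Finset.univ_nonempty (fun d : D => mdpEta (π d) (r d) β) := by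
  apply le_antisymm
  · refine le_inf' _ _ fun d _ => ?_
    obtain ⟨l, hl₁, hl₂⟩ := hcover d
    refine (inf'_le _ (mem_univ l)).trans
      (mdpEta_le_of_pseudo_optimal π r hπsum hβ (hopt l) ?_)
    rw [abs_sub_comm (mdpMean (π (dl l)) (r (dl l))), abs_le]
    constructor <;> linarith
  · exact le_inf' _ _ fun l _ => inf'_le _ (mem_univ (dl l))
end
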